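/- Let f be a function of critical growth on 𝔹² satisfying in addition condition (C̄3): F(x,t) ≤ C(g(x) + f(x,t)) for all x ∈ B and t > 0, with a nonnegative g belonging to L¹(B, dv_g) ∩ L^p(B, dv_g) for some p ∈ (1,2], and condition (C5). Then for every μ > 0 there exists a constant C(μ) > 0 such that for every H¹(𝔹²)-function u, ∫_B f(x,u(x))u(x) dv_g ≤ C(μ)(1 + I_λ(u)) + μ ‖u‖². -/

import Mathlib

open MeasureTheory Real Set Filter

noncomputable section

/-- Points of the plane. -/
abbrev Pt := EuclideanSpace ℝ (Fin 2)

/-- The open unit disc `B = {x ∈ ℝ² : |x| < 1}`. -/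
def B : Set Pt := Metric.ball 0 1

/-- The density of the hyperbolic volume measure `dv_g = (2/(1-|x|²))² dx`. -/
def dens (x : Pt) : ℝ := (2 / (1 - ‖x‖ ^ 2)) ^ 2

/-- Integral with respect to the hyperbolic volume measure on `B`. -/
def hInt (φ : Pt → ℝ) : ℝ := ∫ x in B, φ x * dens x

/-- Integrability with respect to the hyperbolic volume measure on `B`. -/
def HIntegrable (φ : Pt → ℝ) : Prop := IntegrableOn (fun x => φ x * dens x) B volume

/-- The squared Euclidean Dirichlet norm `‖u‖² = ∫_B |∇u|² dx` (which equals the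
hyperbolic Dirichlet energy by conformal invariance). -/
def enormSq (u : Pt → ℝ) : ℝ := ∫ x in B, ‖gradient u x‖ ^ 2

/-- `u` is an `H¹(𝔹²)`-function: differentiable on `B`, with finite Dirichlet
energy and finite hyperbolic `L²` norm. -/
def IsH1 (u : Pt → ℝ) : Prop :=
  DifferentiableOn ℝ u B ∧
  IntegrableOn (fun x => ‖gradient u x‖ ^ 2) B volume ∧
  HIntegrable (fun x => (u x) ^ 2)

/-- `u` is an `H¹_R(𝔹²)`-function: an `H¹(𝔹²)`-function which is radial. -/
def IsH1R (u : Pt → ℝ) : Prop :=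
  IsH1 u ∧ ∀ x y : Pt, ‖x‖ = ‖y‖ → u x = u y

/-- The nonlinearity `f(x,t) = h(x,t)(e^{λt²} - 1)`. -/
def fn (lam : ℝ) (h : Pt → ℝ → ℝ) (x : Pt) (t : ℝ) : ℝ :=
  h x t * (Real.exp (lam * t ^ 2) - 1)

/-- The primitive `F(x,t) = ∫₀^t f(x,s) ds`. -/
def Fn (lam : ℝ) (h : Pt → ℝ → ℝ) (x : Pt) (t : ℝ) : ℝ :=
  ∫ s in (0 : ℝ)..t, fn lam h x s

/-- The functional `I_λ(u) = (1/2)∫_B f(x,u)u dv_g - ∫_B F(x,u) dv_g`. -/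
def Ilam (lam : ℝ) (h : Pt → ℝ → ℝ) (u : Pt → ℝ) : ℝ :=
  (1 / 2) * hInt (fun x => fn lam h x (u x) * u x) - hInt (fun x => Fn lam h x (u x))

/-- `f(x,t) = h(x,t)(e^{λt²} - 1)` is a function of critical growth on `𝔹²`. -/
structure CriticalGrowth (lam : ℝ) (h : Pt → ℝ → ℝ) : Prop where
  lam_pos : 0 < lam
  h_C1 : ContDiff ℝ 1 (Function.uncurry h)
  f_pos : ∀ x ∈ B, ∀ t : ℝ, 0 < t → 0 < fn lam h x t
  f_odd : ∀ x ∈ B, ∀ t : ℝ, fn lam h x (-t) = -fn lam h x t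
  /-- (C1), first part: `h` is bounded on `B × [-L, L]` for every `L > 0`. -/
  h_bdd : ∀ L : ℝ, 0 < L → ∃ C : ℝ, ∀ x ∈ B, ∀ t : ℝ, |t| ≤ L → |h x t| ≤ C
  /-- (C1), second part: `sup_{x ∈ B} |h(x,t)| ≤ C tᵃ` near `t = 0`. -/
  h_zero : ∃ a C δ : ℝ, 0 < a ∧ 0 < C ∧ 0 < δ ∧
    ∀ x ∈ B, ∀ t : ℝ, 0 < t → t < δ → |h x t| ≤ C * t ^ a
  /-- (C2): `∂f/∂t (x,t) > f(x,t)/t` for `t > 0`. -/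
  f_super : ∀ x ∈ B, ∀ t : ℝ, 0 < t → fn lam h x t / t < deriv (fun s => fn lam h x s) t
  /-- (C3): `F(x,t) ≤ M₁(g(x) + f(x,t))` with `0 ≤ g ∈ L¹(B, dv_g)`. -/
  F_bound : ∃ M₁ : ℝ, 0 < M₁ ∧ ∃ g : Pt → ℝ, (∀ x, 0 ≤ g x) ∧ HIntegrable g ∧
    ∀ x ∈ B, ∀ t : ℝ, 0 < t → Fn lam h x t ≤ M₁ * (g x + fn lam h x t)
  /-- (C4), first part: `inf_{x ∈ K} h(x,t) e^{εt²} → ∞` as `t → ∞`,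
  for every compact `K ⊆ B`. -/
  h_inf : ∀ ε : ℝ, 0 < ε → ∀ K : Set Pt, K ⊆ B → IsCompact K →
    ∀ c : ℝ, ∃ T : ℝ, ∀ t : ℝ, T ≤ t → ∀ x ∈ K, c ≤ h x t * Real.exp (ε * t ^ 2)
  /-- (C4), second part: `sup_{x ∈ B} h(x,t) e^{-εt²} → 0` as `t → ∞`. -/
  h_sup : ∀ ε : ℝ, 0 < ε → ∀ c : ℝ, 0 < c → ∃ T : ℝ, ∀ t : ℝ, T ≤ t → ∀ x ∈ B,
    h x t * Real.exp (-ε * t ^ 2) < c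

/-- Condition (C̄3): `F(x,t) ≤ C(g(x) + f(x,t))` with a nonnegative
`g ∈ L¹(B, dv_g) ∩ Lᵖ(B, dv_g)` for some `p ∈ (1,2]`. -/
def CondC3bar (lam : ℝ) (h : Pt → ℝ → ℝ) : Prop :=
  ∃ C : ℝ, 0 < C ∧ ∃ g : Pt → ℝ, (∀ x, 0 ≤ g x) ∧ HIntegrable g ∧
    (∃ p : ℝ, 1 < p ∧ p ≤ 2 ∧ HIntegrable (fun x => (g x) ^ p)) ∧
    ∀ x ∈ B, ∀ t : ℝ, 0 < t → Fn lam h x t ≤ C * (g x + fn lam h x t)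

/-- Condition (C5): there are `δ > 0` and `α₀ ∈ (0,1)` with
`|h(x,t)| ≤ C_N (1-|x|²)^δ` for `α₀ < |x| < 1` and `|t| ≤ N`. -/
def CondC5 (h : Pt → ℝ → ℝ) : Prop :=
  ∃ δ : ℝ, 0 < δ ∧ ∃ α₀ : ℝ, α₀ ∈ Ioo (0 : ℝ) 1 ∧
    ∀ N : ℝ, 0 < N → ∃ C : ℝ, 0 < C ∧
      ∀ x : Pt, α₀ < ‖x‖ → ‖x‖ < 1 → ∀ t : ℝ, |t| ≤ N →
        |h x t| ≤ C * (1 - ‖x‖ ^ 2) ^ δ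

open Topology

/-! ### A Sobolev inequality for differentiable functions on the plane -/

lemma enorm_le_lintegral_enorm_deriv {f : ℝ → ℝ} (hf : Differentiable ℝ f) {R : ℝ}
    (hR : ∀ s, s ≤ R → f s = 0) (x : ℝ) : ‖f x‖ₑ ≤ ∫⁻ s, ‖deriv f s‖ₑ := by
  by_cases hfin : ∫⁻ s, ‖deriv f s‖ₑ = ⊤
  · rw [hfin]; exact le_top
  have hint : Integrable (deriv f) :=
    ⟨(measurable_deriv f).aestronglyMeasurable, lt_of_le_of_ne le_top hfin⟩
  have hFTC := intervalIntegral.integral_eq_sub_of_hasDerivAt (a := R) (b := x)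
    (fun y _ => (hf y).hasDerivAt) hint.intervalIntegrable
  rw [hR R le_rfl, sub_zero] at hFTC
  rw [← hFTC, ← ofReal_norm, ← ofReal_integral_norm_eq_lintegral_enorm hint]
  refine ENNReal.ofReal_le_ofReal ?_
  refine (intervalIntegral.norm_integral_le_integral_norm_uIoc).trans ?_
  exact setIntegral_le_integral hint.norm (Eventually.of_forall fun _ => norm_nonneg _)

/-- Gagliardo–Nirenberg–Sobolev in the plane, for functions that are merely differentiable. -/
lemma lintegral_sq_le_sq_lintegral_fderiv {v : Pt → ℝ} (hv : Differentiable ℝ v) {R : ℝ}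
    (hR : ∀ x, R ≤ ‖x‖ → v x = 0) :
    ∫⁻ x, ‖v x‖ₑ ^ 2 ≤ (∫⁻ x, ‖fderiv ℝ v x‖ₑ) ^ 2 := by
  have hmp := PiLp.volume_preserving_toLp (Fin 2)
  have hme : MeasurableEmbedding (WithLp.toLp 2 : (Fin 2 → ℝ) → Pt) :=
    (MeasurableEquiv.toLp 2 (Fin 2 → ℝ)).measurableEmbedding
  rw [← hmp.lintegral_comp_emb hme, ← hmp.lintegral_comp_emb hme]
  have key := lintegral_prod_lintegral_pow_le (μ := fun _ : Fin 2 => (volume : Measure ℝ))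
    (p := 2) (by simpa using Real.HolderConjugate.two_two)
    (f := fun x : Fin 2 → ℝ => ‖fderiv ℝ v (WithLp.toLp 2 x)‖ₑ)
    ((measurable_fderiv ℝ v).enorm.comp hmp.measurable)
  rw [← volume_pi] at key
  simp only [ENNReal.rpow_two] at key
  refine le_trans (lintegral_mono fun x => ?_) key
  have hline : ∀ i : Fin 2, ‖v (WithLp.toLp 2 x)‖ₑ ≤
      ∫⁻ s, ‖fderiv ℝ v (WithLp.toLp 2 (Function.update x i s))‖ₑ := by
    intro i
    have hγ : ∀ s : ℝ, HasDerivAt (fun s : ℝ => (WithLp.toLp 2 (Function.update x i s) : Pt))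
        (EuclideanSpace.single i (1 : ℝ)) s := by
      intro s
      have h1 := hasDerivAt_update x i s
      have h2 := ((PiLp.continuousLinearEquiv 2 ℝ (fun _ : Fin 2 => ℝ)).symm
        |>.toContinuousLinearMap.hasFDerivAt).comp_hasDerivAt s h1
      exact h2
    have hc : ∀ s, HasDerivAt (fun s : ℝ => v (WithLp.toLp 2 (Function.update x i s)))
        (fderiv ℝ v (WithLp.toLp 2 (Function.update x i s)) (EuclideanSpace.single i (1 : ℝ))) s :=
      fun s => (hv _).hasFDerivAt.comp_hasDerivAt s (hγ s)
    have h0 : ∀ s, s ≤ -|R| → v (WithLp.toLp 2 (Function.update x i s)) = 0 := by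
      intro s hs
      apply hR
      have := PiLp.norm_apply_le (WithLp.toLp 2 (Function.update x i s) : Pt) i
      simp only [Function.update_self, Real.norm_eq_abs] at this
      refine le_trans ?_ this
      have h1 := neg_abs_le s
      have h2 := le_abs_self R
      linarith
    have := enorm_le_lintegral_enorm_deriv (fun s => (hc s).differentiableAt) h0 (x i)
    rw [Function.update_eq_self] at this
    refine this.trans (lintegral_mono fun s => ?_)
    rw [(hc s).deriv, ← ofReal_norm, ← ofReal_norm]
    refine ENNReal.ofReal_le_ofReal ((ContinuousLinearMap.le_opNorm _ _).trans ?_)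
    simp
  rw [Fin.prod_univ_two, pow_two]
  have h1 : (1 : ℝ) / ((Fintype.card (Fin 2) : ℝ) - 1) = 1 := by norm_num
  rw [h1, ENNReal.rpow_one, ENNReal.rpow_one]
  exact mul_le_mul' (hline 0) (hline 1)

/-! ### Hyperbolic Hardy and Sobolev inequalities for compactly supported functions -/

/-- The defining function `1 - |x|²` of the disc. -/
def rho (x : Pt) : ℝ := 1 - ‖x‖ ^ 2

lemma continuous_rho : Continuous rho := by unfold rho; fun_prop

lemma mem_B_iff {x : Pt} : x ∈ B ↔ 0 < rho x := by
  rw [B, mem_ball_zero_iff, rho, sub_pos, sq_lt_one_iff₀ (norm_nonneg x)]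

lemma norm_le_one_of_rho_nonneg {x : Pt} (hx : 0 ≤ rho x) : ‖x‖ ≤ 1 := by
  rw [rho, sub_nonneg, sq_le_one_iff₀ (norm_nonneg x)] at hx
  exact hx

lemma rho_nonpos_of_one_le {x : Pt} (hx : 1 ≤ ‖x‖) : rho x ≤ 0 := by
  rw [rho, sub_nonpos]; exact one_le_pow₀ hx

lemma hasFDerivAt_rho (x : Pt) : HasFDerivAt rho (-((2 : ℝ) • innerSL ℝ x)) x := by
  refine ((hasStrictFDerivAt_norm_sq x).hasFDerivAt.const_sub 1).congr_fderiv ?_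
  ext y
  simp

section CompactSupport

variable {w : Pt → ℝ} {c : ℝ}

lemma hasFDerivAt_zero_of_rho_lt (hw0 : ∀ x, rho x ≤ c → w x = 0) {x : Pt} (hx : rho x < c) :
    HasFDerivAt w (0 : Pt →L[ℝ] ℝ) x := by
  refine (hasFDerivAt_const (0 : ℝ) x).congr_of_eventuallyEq ?_
  filter_upwards [continuous_rho.continuousAt.eventually_lt continuousAt_const hx] with y hy
  exact hw0 y hy.le

lemma hasFDerivAt_div_rho (hw : Differentiable ℝ w) (hc : 0 < c)
    (hw0 : ∀ x, rho x ≤ c → w x = 0) (x : Pt) :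
    HasFDerivAt (fun x => w x / rho x)
      ((1 / rho x) • fderiv ℝ w x + (2 * (w x / rho x ^ 2)) • innerSL ℝ x) x := by
  by_cases hx : rho x = 0
  · have h0 : HasFDerivAt (fun x => w x / rho x) (0 : Pt →L[ℝ] ℝ) x :=
      hasFDerivAt_zero_of_rho_lt (c := c) (fun y hy => by simp [hw0 y hy]) (hx ▸ hc)
    simpa [hx] using h0
  · have h1 := (hw x).hasFDerivAt.mul ((hasDerivAt_inv hx).comp_hasFDerivAt x (hasFDerivAt_rho x))
    refine (h1.congr_fderiv ?_).congr_of_eventuallyEq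
      (Eventually.of_forall fun y => div_eq_mul_inv _ _)
    ext y
    simp
    field_simp
    ring

lemma differentiable_div_rho (hw : Differentiable ℝ w) (hc : 0 < c)
    (hw0 : ∀ x, rho x ≤ c → w x = 0) : Differentiable ℝ fun x => w x / rho x :=
  fun x => (hasFDerivAt_div_rho hw hc hw0 x).differentiableAt

lemma hasCompactSupport_of_rho (hc : 0 < c) (hw0 : ∀ x, rho x ≤ c → w x = 0) :
    HasCompactSupport w := by
  refine HasCompactSupport.intro (isCompact_closedBall (0 : Pt) 1) fun x hx => hw0 x ?_
  rw [mem_closedBall_zero_iff, not_le] at hx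
  exact (rho_nonpos_of_one_le hx.le).trans hc.le

lemma integrable_div_rho_sq (hw : Differentiable ℝ w) (hc : 0 < c)
    (hw0 : ∀ x, rho x ≤ c → w x = 0) : Integrable fun x => w x / rho x ^ 2 := by
  have h1 := differentiable_div_rho hw hc hw0
  have h2 := differentiable_div_rho h1 hc (fun y hy => by simp [hw0 y hy])
  have h3 : (fun x => w x / rho x ^ 2) = fun x => w x / rho x / rho x := by
    ext x; rw [div_div, pow_two]
  rw [h3]
  exact h2.continuous.integrable_of_hasCompactSupport
    (hasCompactSupport_of_rho hc fun y hy => by simp [hw0 y hy])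

lemma integrable_norm_fderiv_div_rho (hc : 0 < c)
    (hw0 : ∀ x, rho x ≤ c → w x = 0) (hi : Integrable fun x => ‖fderiv ℝ w x‖) :
    Integrable fun x => ‖fderiv ℝ w x‖ / rho x := by
  refine (hi.div_const c).mono' ((measurable_fderiv ℝ w).norm.div
    continuous_rho.measurable).aestronglyMeasurable (Eventually.of_forall fun x => ?_)
  rcases lt_or_ge (rho x) c with h | h
  · simp [(hasFDerivAt_zero_of_rho_lt hw0 h).fderiv]
  · have : 0 < rho x := hc.trans_le h
    rw [Real.norm_of_nonneg (by positivity)]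
    gcongr

lemma norm_fderiv_div_rho_le (hw : Differentiable ℝ w) (hwn : ∀ x, 0 ≤ w x) (hc : 0 < c)
    (hw0 : ∀ x, rho x ≤ c → w x = 0) (x : Pt) :
    ‖fderiv ℝ (fun x => w x / rho x) x‖ ≤ ‖fderiv ℝ w x‖ / rho x + 2 * (w x / rho x ^ 2) := by
  rw [(hasFDerivAt_div_rho hw hc hw0 x).fderiv]
  rcases lt_or_ge (rho x) c with h | h
  · simp [(hasFDerivAt_zero_of_rho_lt hw0 h).fderiv, hw0 x h.le]
  · have hr : 0 < rho x := hc.trans_le h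
    have hx := norm_le_one_of_rho_nonneg hr.le
    have hn := hwn x
    refine (norm_add_le _ _).trans (add_le_add ?_ ?_)
    · rw [norm_smul, Real.norm_of_nonneg (by positivity), one_div_mul_eq_div]
    · rw [norm_smul, Real.norm_of_nonneg (by positivity), innerSL_apply_norm]
      exact mul_le_of_le_one_right (by positivity) hx

lemma integral_fderiv_apply_eq_zero {φ : Pt → ℝ} (hφ : Differentiable ℝ φ) (hi : Integrable φ)
    (v : Pt) (hi' : Integrable fun x => fderiv ℝ φ x v) : ∫ x, fderiv ℝ φ x v = 0 := by
  have := integral_mul_fderiv_eq_neg_fderiv_mul_of_integrable (μ := (volume : Measure Pt))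
    (f := φ) (g := fun _ => (1 : ℝ)) (v := v) (by simpa using hi') (by simp) (by simpa using hi)
    (fun x _ => hφ x) (fun x _ => differentiableAt_const _)
  simpa using this

/-- The `L¹` Hardy inequality, from the identity `div (x / (1 - |x|²)) = 2 / (1 - |x|²)²`. -/
lemma integral_div_rho_sq_le (hw : Differentiable ℝ w) (hwn : ∀ x, 0 ≤ w x) (hc : 0 < c)
    (hw0 : ∀ x, rho x ≤ c → w x = 0) (hi : Integrable fun x => ‖fderiv ℝ w x‖) :
    2 * ∫ x, w x / rho x ^ 2 ≤ ∫ x, ‖fderiv ℝ w x‖ / rho x := by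
  have hG := integrable_norm_fderiv_div_rho hc hw0 hi
  have hH := integrable_div_rho_sq hw hc hw0
  have hv := differentiable_div_rho hw hc hw0
  have hvcs : HasCompactSupport fun x => w x / rho x :=
    hasCompactSupport_of_rho hc fun y hy => by simp [hw0 y hy]
  have hvi : Integrable fun x => w x / rho x := hv.continuous.integrable_of_hasCompactSupport hvcs
  have hcoord : ∀ (i : Fin 2) (x : Pt), HasFDerivAt (fun x : Pt => x i)
      (EuclideanSpace.proj i : Pt →L[ℝ] ℝ) x := fun i x =>
    (EuclideanSpace.proj i : Pt →L[ℝ] ℝ).hasFDerivAt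
  have hφ : ∀ (i : Fin 2) (x : Pt), HasFDerivAt (fun x : Pt => w x / rho x * x i)
      ((w x / rho x) • (EuclideanSpace.proj i : Pt →L[ℝ] ℝ) +
        x i • fderiv ℝ (fun x => w x / rho x) x) x := fun i x =>
    (hv x).hasFDerivAt.mul (hcoord i x)
  have hφi : ∀ i : Fin 2, Integrable fun x : Pt => w x / rho x * x i := fun i =>
    (hv.continuous.mul (by fun_prop)).integrable_of_hasCompactSupport hvcs.mul_right
  have hφ' : ∀ (i : Fin 2) (x : Pt),
      fderiv ℝ (fun x : Pt => w x / rho x * x i) x (EuclideanSpace.single i 1) =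
        w x / rho x + x i * fderiv ℝ (fun x => w x / rho x) x (EuclideanSpace.single i 1) := by
    intro i x
    rw [(hφ i x).fderiv]
    simp
  have hφ'i : ∀ i : Fin 2, Integrable fun x : Pt =>
      fderiv ℝ (fun x : Pt => w x / rho x * x i) x (EuclideanSpace.single i 1) := by
    intro i
    refine ((hvi.norm).add (hG.add (hH.const_mul 2))).mono'
      (measurable_fderiv_apply_const ℝ _ _).aestronglyMeasurable (Eventually.of_forall fun x => ?_)
    rw [hφ']
    refine (norm_add_le _ _).trans (add_le_add le_rfl ?_)
    rw [norm_mul]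
    have h1 : ‖fderiv ℝ (fun x => w x / rho x) x (EuclideanSpace.single i 1)‖ ≤
        ‖fderiv ℝ (fun x => w x / rho x) x‖ := by
      simpa using (fderiv ℝ (fun x => w x / rho x) x).le_opNorm (EuclideanSpace.single i 1)
    have h2 := norm_fderiv_div_rho_le hw hwn hc hw0 x
    rcases lt_or_ge (rho x) c with h | h
    · have : HasFDerivAt (fun x => w x / rho x) (0 : Pt →L[ℝ] ℝ) x :=
        hasFDerivAt_zero_of_rho_lt (c := c) (fun y hy => by simp [hw0 y hy]) h
      simp [this.fderiv, (hasFDerivAt_zero_of_rho_lt hw0 h).fderiv, hw0 x h.le]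
    · have hx : ‖x i‖ ≤ 1 :=
        (PiLp.norm_apply_le x i).trans (norm_le_one_of_rho_nonneg (hc.le.trans h))
      exact (mul_le_of_le_one_left (norm_nonneg _) hx).trans (h1.trans h2)
  have hz : ∀ i : Fin 2, ∫ x : Pt,
      fderiv ℝ (fun x : Pt => w x / rho x * x i) x (EuclideanSpace.single i 1) = 0 := fun i =>
    integral_fderiv_apply_eq_zero (fun x => (hφ i x).differentiableAt) (hφi i) _ (hφ'i i)
  have hsum := integral_add (hφ'i 0) (hφ'i 1)
  rw [hz, hz, add_zero] at hsum
  have hsum' := integral_add (hG.sub (hH.const_mul 2)) ((hφ'i 0).add (hφ'i 1))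
  simp only [Pi.sub_apply, Pi.add_apply] at hsum'
  rw [hsum, add_zero, integral_sub hG (hH.const_mul 2), integral_const_mul] at hsum'
  rw [← sub_nonneg, ← hsum']
  refine integral_nonneg fun x => ?_
  simp only [hφ', Pi.zero_apply]
  rcases lt_or_ge (rho x) c with h | h
  · have : HasFDerivAt (fun x => w x / rho x) (0 : Pt →L[ℝ] ℝ) x :=
      hasFDerivAt_zero_of_rho_lt (c := c) (fun y hy => by simp [hw0 y hy]) h
    simp [this.fderiv, (hasFDerivAt_zero_of_rho_lt hw0 h).fderiv, hw0 x h.le]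
  · have hr : 0 < rho x := hc.trans_le h
    have hdec : x = x 0 • EuclideanSpace.single 0 (1 : ℝ) +
        x 1 • EuclideanSpace.single 1 (1 : ℝ) := by
      ext i; fin_cases i <;> simp
    have hx2 : x 0 * x 0 + x 1 * x 1 = ‖x‖ ^ 2 := by
      rw [EuclideanSpace.norm_sq_eq, Fin.sum_univ_two]; simp [pow_two]
    have hDx : fderiv ℝ w x x = x 0 * fderiv ℝ w x (EuclideanSpace.single 0 1) +
        x 1 * fderiv ℝ w x (EuclideanSpace.single 1 1) := by
      refine (congrArg (fderiv ℝ w x) hdec).trans ?_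
      rw [map_add, map_smul, map_smul, smul_eq_mul, smul_eq_mul]
    have hbd : -(‖fderiv ℝ w x‖) ≤ fderiv ℝ w x x := by
      have h1 := (fderiv ℝ w x).le_opNorm x
      have h2 := mul_le_of_le_one_right (norm_nonneg (fderiv ℝ w x))
        (norm_le_one_of_rho_nonneg hr.le)
      exact (abs_le.1 (h1.trans h2)).1
    rw [(hasFDerivAt_div_rho hw hc hw0 x).fderiv]
    have e1 : ‖x‖ ^ 2 = 1 - rho x := by simp [rho]
    have : ‖fderiv ℝ w x‖ / rho x - 2 * (w x / rho x ^ 2) +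
        (w x / rho x + x 0 * ((1 / rho x) * fderiv ℝ w x (EuclideanSpace.single 0 1) +
            2 * (w x / rho x ^ 2) * x 0) +
          (w x / rho x + x 1 * ((1 / rho x) * fderiv ℝ w x (EuclideanSpace.single 1 1) +
            2 * (w x / rho x ^ 2) * x 1))) = (‖fderiv ℝ w x‖ + fderiv ℝ w x x) / rho x := by
      have : ‖fderiv ℝ w x‖ / rho x - 2 * (w x / rho x ^ 2) +
        (w x / rho x + x 0 * ((1 / rho x) * fderiv ℝ w x (EuclideanSpace.single 0 1) +
            2 * (w x / rho x ^ 2) * x 0) +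
          (w x / rho x + x 1 * ((1 / rho x) * fderiv ℝ w x (EuclideanSpace.single 1 1) +
            2 * (w x / rho x ^ 2) * x 1))) = ‖fderiv ℝ w x‖ / rho x - 2 * (w x / rho x ^ 2) +
            2 * (w x / rho x) + (x 0 * fderiv ℝ w x (EuclideanSpace.single 0 1) +
        x 1 * fderiv ℝ w x (EuclideanSpace.single 1 1)) / rho x +
            2 * (w x / rho x ^ 2) * (x 0 * x 0 + x 1 * x 1) := by ring
      rw [this, ← hDx, hx2, e1]
      field_simp
      ring
    have key : 0 ≤ (‖fderiv ℝ w x‖ + fderiv ℝ w x x) / rho x :=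
      div_nonneg (by linarith) hr.le
    rw [← this] at key
    simpa [EuclideanSpace.inner_single_right] using key

/-- Sobolev inequality for the hyperbolic metric, compactly supported case. -/
lemma integral_sq_div_rho_sq_le (hw : Differentiable ℝ w) (hwn : ∀ x, 0 ≤ w x) (hc : 0 < c)
    (hw0 : ∀ x, rho x ≤ c → w x = 0) (hi : Integrable fun x => ‖fderiv ℝ w x‖) :
    ∫ x, w x ^ 2 / rho x ^ 2 ≤ 4 * (∫ x, ‖fderiv ℝ w x‖ / rho x) ^ 2 := by
  have hG := integrable_norm_fderiv_div_rho hc hw0 hi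
  have hH := integrable_div_rho_sq hw hc hw0
  have hv := differentiable_div_rho hw hc hw0
  have hvcs : HasCompactSupport fun x => w x / rho x :=
    hasCompactSupport_of_rho hc fun y hy => by simp [hw0 y hy]
  have hv2 : Integrable fun x => (w x / rho x) ^ 2 := by
    refine (hv.continuous.pow 2).integrable_of_hasCompactSupport ?_
    exact hasCompactSupport_of_rho hc fun y hy => by simp [hw0 y hy]
  have hdv : Integrable (fderiv ℝ fun x => w x / rho x) :=
    (hG.add (hH.const_mul 2)).mono' (measurable_fderiv ℝ _).aestronglyMeasurable
      (Eventually.of_forall (norm_fderiv_div_rho_le hw hwn hc hw0))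
  have hle : ∫ x, ‖fderiv ℝ (fun x => w x / rho x) x‖ ≤ 2 * ∫ x, ‖fderiv ℝ w x‖ / rho x := by
    calc _ ≤ ∫ x, (‖fderiv ℝ w x‖ / rho x + 2 * (w x / rho x ^ 2)) :=
          integral_mono hdv.norm (hG.add (hH.const_mul 2)) (norm_fderiv_div_rho_le hw hwn hc hw0)
      _ = (∫ x, ‖fderiv ℝ w x‖ / rho x) + 2 * ∫ x, w x / rho x ^ 2 := by
          rw [integral_add hG (hH.const_mul 2), integral_const_mul]
      _ ≤ _ := by linarith [integral_div_rho_sq_le hw hwn hc hw0 hi]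
  have hgn := lintegral_sq_le_sq_lintegral_fderiv hv (R := 1) fun x hx => by
    simp [hw0 x ((rho_nonpos_of_one_le hx).trans hc.le)]
  rw [← ofReal_integral_norm_eq_lintegral_enorm hdv, ← ENNReal.ofReal_pow
    (integral_nonneg fun _ => norm_nonneg _)] at hgn
  have h2 : ∫⁻ x, ‖w x / rho x‖ₑ ^ 2 = ENNReal.ofReal (∫ x, (w x / rho x) ^ 2) := by
    rw [ofReal_integral_eq_lintegral_ofReal hv2 (Eventually.of_forall fun _ => sq_nonneg _)]
    refine lintegral_congr fun x => ?_
    rw [← ofReal_norm, ← ENNReal.ofReal_pow (norm_nonneg _), Real.norm_eq_abs, sq_abs]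
  rw [h2, ENNReal.ofReal_le_ofReal_iff (by positivity)] at hgn
  simp only [div_pow] at hgn
  refine hgn.trans ?_
  have h0 : 0 ≤ ∫ x, ‖fderiv ℝ (fun x => w x / rho x) x‖ := integral_nonneg fun _ => norm_nonneg _
  calc _ ≤ (2 * ∫ x, ‖fderiv ℝ w x‖ / rho x) ^ 2 := by gcongr
    _ = _ := by ring

end CompactSupport

/-! ### Removing the compact support assumption -/

lemma deriv_smoothTransition_of_one_le {s : ℝ} (hs : 1 ≤ s) : deriv smoothTransition s = 0 :=
  IsLocalMax.deriv_eq_zero <| Eventually.of_forall fun y =>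
    (smoothTransition.le_one y).trans_eq (smoothTransition.one_of_one_le hs).symm

lemma deriv_smoothTransition_of_nonpos {s : ℝ} (hs : s ≤ 0) : deriv smoothTransition s = 0 :=
  IsLocalMin.deriv_eq_zero <| Eventually.of_forall fun y =>
    (smoothTransition.zero_of_nonpos hs).trans_le (smoothTransition.nonneg y)

lemma exists_bound_deriv_smoothTransition :
    ∃ M : ℝ, 0 < M ∧ ∀ s, |deriv smoothTransition s| ≤ M := by
  have hc : Continuous (deriv smoothTransition) :=
    (smoothTransition.contDiff (n := 1)).continuous_deriv le_rfl
  obtain ⟨M, hM⟩ := (isCompact_Icc (a := (0 : ℝ)) (b := 1)).exists_bound_of_continuousOn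
    hc.continuousOn
  refine ⟨max M 1, by positivity, fun s => ?_⟩
  rcases lt_or_ge s 0 with hs | hs
  · simp [deriv_smoothTransition_of_nonpos hs.le]
  rcases lt_or_ge 1 s with hs' | hs'
  · simp [deriv_smoothTransition_of_one_le hs'.le]
  exact (hM s ⟨hs, hs'⟩).trans (le_max_left _ _)

lemma exists_cutoff : ∃ (η : ℕ → Pt → ℝ) (M : ℝ), (∀ n, Differentiable ℝ (η n)) ∧
    (∀ n x, 0 ≤ η n x) ∧ (∀ n x, η n x ≤ 1) ∧
    (∀ n, ∃ c, 0 < c ∧ ∀ x, rho x ≤ c → η n x = 0) ∧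
    (∀ n, ∀ x ∈ B, ‖fderiv ℝ (η n) x‖ ≤ M / rho x) ∧
    ∀ x ∈ B, ∀ᶠ n in atTop, η n x = 1 ∧ fderiv ℝ (η n) x = 0 := by
  obtain ⟨M, hM, hM'⟩ := exists_bound_deriv_smoothTransition
  have hd : ∀ (n : ℕ) (x : Pt), HasFDerivAt
      (fun x => smoothTransition (((n : ℝ) + 1) * rho x - 1))
      (deriv smoothTransition (((n : ℝ) + 1) * rho x - 1) •
        ((n : ℝ) + 1) • (-((2 : ℝ) • innerSL ℝ x))) x := fun n x =>
    (((smoothTransition.contDiff (n := 1)).differentiable one_ne_zero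
      _).hasDerivAt).comp_hasFDerivAt x (((hasFDerivAt_rho x).const_mul _).sub_const 1)
  refine ⟨fun n x => smoothTransition (((n : ℝ) + 1) * rho x - 1), 4 * M,
    fun n x => (hd n x).differentiableAt, fun n x => smoothTransition.nonneg _,
    fun n x => smoothTransition.le_one _, fun n => ⟨1 / ((n : ℝ) + 1), by positivity, ?_⟩, ?_, ?_⟩
  · intro x hx
    refine smoothTransition.zero_of_nonpos ?_
    rw [le_div_iff₀ (by positivity)] at hx
    linarith
  · intro n x hx
    have hr := mem_B_iff.1 hx
    rw [(hd n x).fderiv]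
    rcases lt_or_ge 1 (((n : ℝ) + 1) * rho x - 1) with h | h
    · rw [deriv_smoothTransition_of_one_le h.le, zero_smul, norm_zero]; positivity
    · rw [norm_smul, norm_smul, norm_neg, norm_smul, innerSL_apply_norm, Real.norm_eq_abs,
        Real.norm_of_nonneg (by positivity : (0 : ℝ) ≤ (n : ℝ) + 1), Real.norm_ofNat,
        le_div_iff₀ hr]
      have hx1 := norm_le_one_of_rho_nonneg hr.le
      calc |deriv smoothTransition (((n : ℝ) + 1) * rho x - 1)| *
            (((n : ℝ) + 1) * (2 * ‖x‖)) * rho x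
          ≤ M * (((n : ℝ) + 1) * (2 * 1)) * rho x := by
            gcongr
            exact hM' _
        _ = 2 * M * (((n : ℝ) + 1) * rho x) := by ring
        _ ≤ 2 * M * 2 := by gcongr; linarith
        _ = 4 * M := by ring
  · intro x hx
    have hr := mem_B_iff.1 hx
    filter_upwards [(tendsto_natCast_atTop_atTop (R := ℝ)).eventually_gt_atTop (2 / rho x)]
      with n hn
    rw [div_lt_iff₀ hr] at hn
    have : 1 < ((n : ℝ) + 1) * rho x - 1 := by nlinarith
    exact ⟨smoothTransition.one_of_one_le this.le,
      by rw [(hd n x).fderiv, deriv_smoothTransition_of_one_le this.le, zero_smul]⟩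

lemma measurableSet_B : MeasurableSet B := measurableSet_ball

lemma isOpen_B : IsOpen B := Metric.isOpen_ball

/-- The `L¹` Hardy inequality and the hyperbolic Sobolev inequality on the disc. -/
lemma hardy_sobolev_on_disc {W : Pt → ℝ} (hW : DifferentiableOn ℝ W B) (hWn : ∀ x ∈ B, 0 ≤ W x)
    (hi₁ : IntegrableOn (fun x => W x / rho x ^ 2) B)
    (hi₂ : IntegrableOn (fun x => ‖fderiv ℝ W x‖ / rho x) B) :
    2 * ∫ x in B, W x / rho x ^ 2 ≤ ∫ x in B, ‖fderiv ℝ W x‖ / rho x ∧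
    ((∀ x ∈ B, W x ≤ 1) →
      ∫ x in B, W x ^ 2 / rho x ^ 2 ≤ 4 * (∫ x in B, ‖fderiv ℝ W x‖ / rho x) ^ 2) := by
  obtain ⟨η, M, hηd, hη0, hη1, hηc, hηM, hηl⟩ := exists_cutoff
  set w : ℕ → Pt → ℝ := fun n x => η n x * W x with hw
  have hw0 : ∀ n c, (∀ x, rho x ≤ c → η n x = 0) → ∀ x, rho x ≤ c → w n x = 0 :=
    fun n c h x hx => by simp [hw, h x hx]
  have hWat : ∀ x ∈ B, DifferentiableAt ℝ W x := fun x hx =>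
    hW.differentiableAt (isOpen_B.mem_nhds hx)
  have hwB : ∀ n, ∀ x ∈ B, HasFDerivAt (w n) (η n x • fderiv ℝ W x + W x • fderiv ℝ (η n) x) x :=
    fun n x hx => (hηd n x).hasFDerivAt.mul (hWat x hx).hasFDerivAt
  have hwout : ∀ n, ∀ x ∉ B, HasFDerivAt (w n) (0 : Pt →L[ℝ] ℝ) x := by
    intro n x hx
    obtain ⟨c, hc, hc0⟩ := hηc n
    rw [mem_B_iff, not_lt] at hx
    exact hasFDerivAt_zero_of_rho_lt (hw0 n c hc0) (hx.trans_lt hc)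
  have hwd : ∀ n, Differentiable ℝ (w n) := fun n x => by
    by_cases hx : x ∈ B
    · exact (hwB n x hx).differentiableAt
    · exact (hwout n x hx).differentiableAt
  have hwn : ∀ n x, 0 ≤ w n x := by
    intro n x
    by_cases hx : x ∈ B
    · exact mul_nonneg (hη0 n x) (hWn x hx)
    · obtain ⟨c, hc, hc0⟩ := hηc n
      rw [mem_B_iff, not_lt] at hx
      rw [hw0 n c hc0 x (hx.trans hc.le)]
  have hbd : ∀ n, ∀ x ∈ B, ‖fderiv ℝ (w n) x‖ ≤
      ‖fderiv ℝ W x‖ + W x * ‖fderiv ℝ (η n) x‖ := by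
    intro n x hx
    rw [(hwB n x hx).fderiv]
    refine (norm_add_le _ _).trans (add_le_add ?_ ?_)
    · rw [norm_smul, Real.norm_of_nonneg (hη0 n x)]
      exact mul_le_of_le_one_left (norm_nonneg _) (hη1 n x)
    · rw [norm_smul, Real.norm_of_nonneg (hWn x hx)]
  have hcut : ∀ n, ∀ x ∈ B, W x * ‖fderiv ℝ (η n) x‖ / rho x ≤ M * (W x / rho x ^ 2) := by
    intro n x hx
    have hr := mem_B_iff.1 hx
    calc _ ≤ W x * (M / rho x) / rho x := by
          gcongr
          · exact hWn x hx
          · exact hηM n x hx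
      _ = _ := by field_simp
  have hcutm : ∀ n, AEStronglyMeasurable (fun x => W x * ‖fderiv ℝ (η n) x‖ / rho x)
      (volume.restrict B) := by
    intro n
    refine ((hW.continuousOn.aestronglyMeasurable measurableSet_B).mul
      (measurable_fderiv ℝ (η n)).norm.aestronglyMeasurable).div₀ ?_
    exact continuous_rho.aestronglyMeasurable
  have hcuti : ∀ n, IntegrableOn (fun x => W x * ‖fderiv ℝ (η n) x‖ / rho x) B := by
    intro n
    refine (hi₁.const_mul M).mono' (hcutm n) ?_
    filter_upwards [ae_restrict_mem measurableSet_B] with x hx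
    have hr := mem_B_iff.1 hx
    rw [Real.norm_of_nonneg (by have := hWn x hx; positivity)]
    exact hcut n x hx
  have hrho1 : ∀ x, rho x ≤ 1 := fun x => by rw [rho]; linarith [sq_nonneg ‖x‖]
  have hquot : ∀ n, ∀ x ∈ B, ‖fderiv ℝ (w n) x‖ / rho x ≤
      ‖fderiv ℝ W x‖ / rho x + W x * ‖fderiv ℝ (η n) x‖ / rho x := by
    intro n x hx
    have hr := mem_B_iff.1 hx
    rw [← add_div]
    gcongr
    exact hbd n x hx
  have hwi : ∀ n, Integrable fun x => ‖fderiv ℝ (w n) x‖ := by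
    intro n
    have hs : (fun x => ‖fderiv ℝ (w n) x‖) = B.indicator fun x => ‖fderiv ℝ (w n) x‖ := by
      ext x
      by_cases hx : x ∈ B
      · simp [hx]
      · simp [hx, (hwout n x hx).fderiv]
    rw [hs, integrable_indicator_iff measurableSet_B]
    refine (hi₂.add (hcuti n)).mono' (measurable_fderiv ℝ _).norm.aestronglyMeasurable ?_
    filter_upwards [ae_restrict_mem measurableSet_B] with x hx
    rw [norm_norm]
    refine le_trans ?_ (hquot n x hx)
    rw [le_div_iff₀ (mem_B_iff.1 hx)]
    exact mul_le_of_le_one_right (norm_nonneg _) (hrho1 x)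
  have hR : ∀ n, ∫ x, ‖fderiv ℝ (w n) x‖ / rho x ≤ (∫ x in B, ‖fderiv ℝ W x‖ / rho x) +
      ∫ x in B, W x * ‖fderiv ℝ (η n) x‖ / rho x := by
    intro n
    obtain ⟨c, hc, hc0⟩ := hηc n
    have hG := integrable_norm_fderiv_div_rho hc (hw0 n c hc0) (hwi n)
    rw [← setIntegral_eq_integral_of_forall_compl_eq_zero (s := B)
      (fun x hx => by simp [(hwout n x hx).fderiv]), ← integral_add hi₂ (hcuti n)]
    exact setIntegral_mono_on hG.integrableOn (hi₂.add (hcuti n)) measurableSet_B (hquot n)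
  have hlim : Tendsto (fun n => (∫ x in B, ‖fderiv ℝ W x‖ / rho x) +
      ∫ x in B, W x * ‖fderiv ℝ (η n) x‖ / rho x) atTop
      (𝓝 (∫ x in B, ‖fderiv ℝ W x‖ / rho x)) := by
    have : Tendsto (fun n => ∫ x in B, W x * ‖fderiv ℝ (η n) x‖ / rho x) atTop
        (𝓝 (∫ x in B, (0 : ℝ))) := by
      refine tendsto_integral_of_dominated_convergence (fun x => M * (W x / rho x ^ 2)) hcutm
        (hi₁.const_mul M) (fun n => ?_) ?_
      · filter_upwards [ae_restrict_mem measurableSet_B] with x hx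
        have hr := mem_B_iff.1 hx
        rw [Real.norm_of_nonneg (by have := hWn x hx; positivity)]
        exact hcut n x hx
      · filter_upwards [ae_restrict_mem measurableSet_B] with x hx
        refine tendsto_const_nhds.congr' ?_
        filter_upwards [hηl x hx] with n hn
        simp [hn.2]
    simpa using this.const_add (∫ x in B, ‖fderiv ℝ W x‖ / rho x)
  have hpow : ∀ k : ℕ, k ≠ 0 → IntegrableOn (fun x => W x ^ k / rho x ^ 2) B →
      Tendsto (fun n => ∫ x, w n x ^ k / rho x ^ 2) atTop
        (𝓝 (∫ x in B, W x ^ k / rho x ^ 2)) := by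
    intro k hk hik
    have hs : ∀ n, ∫ x, w n x ^ k / rho x ^ 2 = ∫ x in B, w n x ^ k / rho x ^ 2 := by
      intro n
      obtain ⟨c, hc, hc0⟩ := hηc n
      rw [setIntegral_eq_integral_of_forall_compl_eq_zero]
      intro x hx
      rw [mem_B_iff, not_lt] at hx
      simp [hw0 n c hc0 x (hx.trans hc.le), hk]
    simp only [hs]
    refine tendsto_integral_of_dominated_convergence (fun x => W x ^ k / rho x ^ 2)
      (fun n => ?_) hik (fun n => ?_) ?_
    · exact (((hwd n).continuous.pow k).measurable.div
        (continuous_rho.pow 2).measurable).aestronglyMeasurable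
    · filter_upwards [ae_restrict_mem measurableSet_B] with x hx
      have hr := mem_B_iff.1 hx
      rw [Real.norm_of_nonneg (by have := hwn n x; positivity)]
      gcongr
      · exact hwn n x
      · exact mul_le_of_le_one_left (hWn x hx) (hη1 n x)
    · filter_upwards [ae_restrict_mem measurableSet_B] with x hx
      refine tendsto_const_nhds.congr' ?_
      filter_upwards [hηl x hx] with n hn
      simp [hw, hn.1]
  refine ⟨?_, fun hW1 => ?_⟩
  · have h1 := hpow 1 one_ne_zero (by simpa using hi₁)
    simp only [pow_one] at h1
    refine le_of_tendsto_of_tendsto' (h1.const_mul 2) hlim fun n => ?_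
    obtain ⟨c, hc, hc0⟩ := hηc n
    exact (integral_div_rho_sq_le (hwd n) (hwn n) hc (hw0 n c hc0) (hwi n)).trans (hR n)
  · have hi : IntegrableOn (fun x => W x ^ 2 / rho x ^ 2) B := by
      refine hi₁.mono' (((hW.continuousOn.aestronglyMeasurable measurableSet_B).pow 2).div₀
        (continuous_rho.pow 2).aestronglyMeasurable) ?_
      filter_upwards [ae_restrict_mem measurableSet_B] with x hx
      rw [Real.norm_of_nonneg (by positivity)]
      gcongr
      exact pow_le_of_le_one (hWn x hx) (hW1 x hx) two_ne_zero
    refine le_of_tendsto_of_tendsto' (hpow 2 two_ne_zero hi) ((hlim.pow 2).const_mul 4) fun n => ?_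
    obtain ⟨c, hc, hc0⟩ := hηc n
    refine (integral_sq_div_rho_sq_le (hwd n) (hwn n) hc (hw0 n c hc0) (hwi n)).trans ?_
    have hnn : 0 ≤ ∫ x, ‖fderiv ℝ (w n) x‖ / rho x := by
      have h1 := integral_div_rho_sq_le (hwd n) (hwn n) hc (hw0 n c hc0) (hwi n)
      refine le_trans ?_ h1
      exact mul_nonneg zero_le_two (integral_nonneg fun x => by
        have := hwn n x
        positivity)
    gcongr
    exact hR n

/-! ### Poincaré inequality and exponential integrability -/

lemma sq_integral_mul_le {α : Type*} [MeasurableSpace α] {μ : Measure α} {a b : α → ℝ}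
    (ha : Integrable (fun x => a x ^ 2) μ) (hb : Integrable (fun x => b x ^ 2) μ)
    (hab : Integrable (fun x => a x * b x) μ) :
    (∫ x, a x * b x ∂μ) ^ 2 ≤ (∫ x, a x ^ 2 ∂μ) * ∫ x, b x ^ 2 ∂μ := by
  have key : ∀ θ : ℝ, 0 ≤ (∫ x, a x ^ 2 ∂μ) * (θ * θ) + (-2 * ∫ x, a x * b x ∂μ) * θ +
      ∫ x, b x ^ 2 ∂μ := by
    intro θ
    have h1 : 0 ≤ ∫ x, ((θ * θ) * a x ^ 2 + (-2 * θ) * (a x * b x) + b x ^ 2) ∂μ :=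
      integral_nonneg fun x => by
        have : (θ * θ) * a x ^ 2 + (-2 * θ) * (a x * b x) + b x ^ 2 = (θ * a x - b x) ^ 2 := by
          ring
        simp only [this, Pi.zero_apply]
        positivity
    have h2 := integral_add ((ha.const_mul (θ * θ)).add (hab.const_mul (-2 * θ))) hb
    simp only [Pi.add_apply] at h2
    rw [h2, integral_add (ha.const_mul _) (hab.const_mul _), integral_const_mul,
      integral_const_mul] at h1
    linarith
  have := discrim_le_zero key
  rw [discrim] at this
  nlinarith

section Trudinger

variable {u : Pt → ℝ}

lemma integral_sq_div_rho_sq_le_energy (hu : DifferentiableOn ℝ u B)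
    (hE : IntegrableOn (fun x => ‖fderiv ℝ u x‖ ^ 2) B)
    (hL : IntegrableOn (fun x => u x ^ 2 / rho x ^ 2) B) :
    ∫ x in B, u x ^ 2 / rho x ^ 2 ≤ ∫ x in B, ‖fderiv ℝ u x‖ ^ 2 := by
  have hd : ∀ x ∈ B, fderiv ℝ (fun x => u x ^ 2) x = (2 * u x) • fderiv ℝ u x := by
    intro x hx
    have := ((hu.differentiableAt (isOpen_B.mem_nhds hx)).hasFDerivAt.pow 2).fderiv
    simpa using this
  have hle : ∀ x ∈ B, ‖fderiv ℝ (fun x => u x ^ 2) x‖ / rho x ≤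
      u x ^ 2 / rho x ^ 2 + ‖fderiv ℝ u x‖ ^ 2 := by
    intro x hx
    rw [hd x hx, norm_smul, norm_mul, Real.norm_ofNat, Real.norm_eq_abs]
    have := two_mul_le_add_sq (|u x| / rho x) ‖fderiv ℝ u x‖
    rw [div_pow, sq_abs] at this
    refine le_trans (le_of_eq ?_) this
    ring
  have hi : IntegrableOn (fun x => ‖fderiv ℝ (fun x => u x ^ 2) x‖ / rho x) B := by
    refine (hL.add hE).mono' ((measurable_fderiv ℝ _).norm.div
      continuous_rho.measurable).aestronglyMeasurable ?_
    filter_upwards [ae_restrict_mem measurableSet_B] with x hx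
    have hr := mem_B_iff.1 hx
    rw [Real.norm_of_nonneg (by positivity)]
    exact hle x hx
  have h1 := (hardy_sobolev_on_disc (W := fun x => u x ^ 2) (hu.fun_pow 2)
    (fun x _ => sq_nonneg (u x)) hL hi).1
  have h2 := setIntegral_mono_on hi (hL.add hE) measurableSet_B hle
  simp only [Pi.add_apply] at h2
  rw [integral_add hL hE] at h2
  linarith

/-- The part of the disc where `u` exceeds `t`. -/
def superlevel (u : Pt → ℝ) (t : ℝ) : Set Pt := {x | x ∈ B ∧ t < u x}

/-- Hyperbolic volume (up to a factor `4`) of a superlevel set. -/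
def levelVolume (u : Pt → ℝ) (t : ℝ) : ℝ := ∫ x in superlevel u t, 1 / rho x ^ 2

/-- Dirichlet energy in a superlevel set. -/
def levelEnergy (u : Pt → ℝ) (t : ℝ) : ℝ := ∫ x in superlevel u t, ‖fderiv ℝ u x‖ ^ 2

lemma superlevel_subset (t : ℝ) : superlevel u t ⊆ B := fun _ hx => hx.1

lemma superlevel_anti {s t : ℝ} (hst : s ≤ t) : superlevel u t ⊆ superlevel u s :=
  fun _ hx => ⟨hx.1, hst.trans_lt hx.2⟩

lemma measurableSet_superlevel (hu : DifferentiableOn ℝ u B) (t : ℝ) :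
    MeasurableSet (superlevel u t) :=
  (hu.continuousOn.isOpen_inter_preimage isOpen_B isOpen_Ioi).measurableSet

lemma integrableOn_superlevel (hu : DifferentiableOn ℝ u B)
    (hL : IntegrableOn (fun x => u x ^ 2 / rho x ^ 2) B) {t : ℝ} (ht : 0 < t) :
    IntegrableOn (fun x => 1 / rho x ^ 2) (superlevel u t) := by
  refine ((hL.mono_set (superlevel_subset t)).div_const (t ^ 2)).mono'
    (measurable_const.div (continuous_rho.pow 2).measurable).aestronglyMeasurable ?_
  filter_upwards [ae_restrict_mem (measurableSet_superlevel hu t)] with x hx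
  have hr := mem_B_iff.1 hx.1
  rw [Real.norm_of_nonneg (by positivity), div_right_comm]
  gcongr
  rw [le_div_iff₀ (by positivity), one_mul]
  exact pow_le_pow_left₀ ht.le hx.2.le 2

lemma levelVolume_nonneg (t : ℝ) : 0 ≤ levelVolume u t := integral_nonneg fun _ => by positivity

lemma levelEnergy_nonneg (t : ℝ) : 0 ≤ levelEnergy u t := integral_nonneg fun _ => by positivity

lemma levelVolume_anti (hu : DifferentiableOn ℝ u B)
    (hL : IntegrableOn (fun x => u x ^ 2 / rho x ^ 2) B) {s t : ℝ} (hs : 0 < s) (hst : s ≤ t) :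
    levelVolume u t ≤ levelVolume u s :=
  setIntegral_mono_set (integrableOn_superlevel hu hL hs)
    (Eventually.of_forall fun _ => by positivity) (superlevel_anti hst).eventuallyLE

lemma exists_levelVolume_step : ∃ K : ℝ, 0 < K ∧ ∀ u : Pt → ℝ, DifferentiableOn ℝ u B →
    IntegrableOn (fun x => ‖fderiv ℝ u x‖ ^ 2) B → IntegrableOn (fun x => u x ^ 2 / rho x ^ 2) B →
    ∀ t s : ℝ, 0 < t → 0 < s →
      levelVolume u (t + s) ≤
        K * (levelEnergy u t - levelEnergy u (t + s)) / s ^ 2 * levelVolume u t := by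
  obtain ⟨M, hM, hM'⟩ := exists_bound_deriv_smoothTransition
  refine ⟨4 * M ^ 2, by positivity, fun u hu hE hL t s ht hs => ?_⟩
  have hsub := superlevel_anti (u := u) (le_add_of_nonneg_right hs.le : t ≤ t + s)
  have hmt := measurableSet_superlevel hu t
  have hmts := measurableSet_superlevel hu (t + s)
  set S := superlevel u t \ superlevel u (t + s) with hS
  have hSm : MeasurableSet S := hmt.diff hmts
  have hSB : S ⊆ B := sdiff_subset.trans (superlevel_subset t)
  set W : Pt → ℝ := fun x => smoothTransition ((u x - t) / s) with hWdef
  have hWd : ∀ x ∈ B, HasFDerivAt W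
      (deriv smoothTransition ((u x - t) / s) • s⁻¹ • fderiv ℝ u x) x := by
    intro x hx
    have h1 := ((hu.differentiableAt (isOpen_B.mem_nhds hx)).hasFDerivAt.sub_const t).const_smul
      s⁻¹
    have h2 := (((smoothTransition.contDiff (n := 1)).differentiable one_ne_zero
      ((u x - t) / s)).hasDerivAt)
    have h3 : (u x - t) / s = (s⁻¹ • fun x => u x - t) x := by simp [div_eq_inv_mul]
    rw [h3] at h2 ⊢
    refine (h2.comp_hasFDerivAt x h1).congr_of_eventuallyEq (Eventually.of_forall fun y => ?_)
    simp [hWdef, div_eq_inv_mul]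
  have hWn : ∀ x, 0 ≤ W x := fun x => smoothTransition.nonneg _
  have hW1 : ∀ x, W x ≤ 1 := fun x => smoothTransition.le_one _
  have hdiff : DifferentiableOn ℝ W B := fun x hx =>
    (hWd x hx).differentiableAt.differentiableWithinAt
  have hvol := integrableOn_superlevel hu hL ht
  have hvolS : IntegrableOn (fun x => 1 / rho x ^ 2) S := hvol.mono_set sdiff_subset
  have hES := hE.mono_set hSB
  have hbd : ∀ x ∈ B, ‖fderiv ℝ W x‖ / rho x ≤
      S.indicator (fun x => M / s * (‖fderiv ℝ u x‖ * (1 / rho x))) x := by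
    intro x hx
    have hr := mem_B_iff.1 hx
    rw [(hWd x hx).fderiv]
    by_cases hxS : x ∈ S
    · rw [indicator_of_mem hxS, norm_smul, norm_smul, Real.norm_eq_abs,
        Real.norm_of_nonneg (by positivity : 0 ≤ s⁻¹)]
      calc _ ≤ M * (s⁻¹ * ‖fderiv ℝ u x‖) / rho x := by
            gcongr
            exact hM' _
        _ = _ := by ring
    · rw [indicator_of_notMem hxS]
      have : deriv smoothTransition ((u x - t) / s) = 0 := by
        by_cases h : t < u x
        · refine deriv_smoothTransition_of_one_le ?_
          have : t + s < u x := by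
            by_contra h'
            exact hxS ⟨⟨hx, h⟩, fun h'' => h' h''.2⟩
          rw [le_div_iff₀ hs]; linarith
        · exact deriv_smoothTransition_of_nonpos
            (div_nonpos_of_nonpos_of_nonneg (by linarith) hs.le)
      simp [this]
  have hcross : IntegrableOn (fun x => ‖fderiv ℝ u x‖ * (1 / rho x)) S := by
    refine (hES.add hvolS).mono' ((measurable_fderiv ℝ _).norm.mul
      (measurable_const.div continuous_rho.measurable)).aestronglyMeasurable ?_
    filter_upwards [ae_restrict_mem hSm] with x hx
    have hr := mem_B_iff.1 (hSB hx)
    rw [Real.norm_of_nonneg (by positivity)]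
    have h1 := two_mul_le_add_sq ‖fderiv ℝ u x‖ (1 / rho x)
    have h2 : 0 ≤ ‖fderiv ℝ u x‖ * (1 / rho x) := by positivity
    rw [div_pow, one_pow] at h1
    simp only [Pi.add_apply]
    linarith
  have hind : IntegrableOn (S.indicator fun x => M / s * (‖fderiv ℝ u x‖ * (1 / rho x))) B :=
    ((integrable_indicator_iff hSm).2 (hcross.const_mul (M / s))).integrableOn
  have hi₂ : IntegrableOn (fun x => ‖fderiv ℝ W x‖ / rho x) B := by
    refine hind.mono' ((measurable_fderiv ℝ _).norm.div
      continuous_rho.measurable).aestronglyMeasurable ?_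
    filter_upwards [ae_restrict_mem measurableSet_B] with x hx
    have hr := mem_B_iff.1 hx
    rw [Real.norm_of_nonneg (by positivity)]
    exact hbd x hx
  have hWle : ∀ x ∈ B, W x / rho x ^ 2 ≤
      (superlevel u t).indicator (fun x => 1 / rho x ^ 2) x := by
    intro x hx
    by_cases h : t < u x
    · rw [indicator_of_mem (show x ∈ superlevel u t from ⟨hx, h⟩)]
      gcongr
      exact hW1 x
    · rw [indicator_of_notMem (fun h' => h h'.2)]
      have : W x = 0 := smoothTransition.zero_of_nonpos
        (div_nonpos_of_nonpos_of_nonneg (by linarith) hs.le)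
      simp [this]
  have hWm : AEStronglyMeasurable W (volume.restrict B) :=
    hdiff.continuousOn.aestronglyMeasurable measurableSet_B
  have hrm : AEStronglyMeasurable (fun x => rho x ^ 2) (volume.restrict B) :=
    (continuous_rho.pow 2).aestronglyMeasurable
  have hi₁ : IntegrableOn (fun x => W x / rho x ^ 2) B := by
    refine (hvol.integrable_indicator hmt).integrableOn.mono' (hWm.div₀ hrm) ?_
    filter_upwards [ae_restrict_mem measurableSet_B] with x hx
    rw [Real.norm_of_nonneg (by have := hWn x; positivity)]
    exact hWle x hx
  have hi₃ : IntegrableOn (fun x => W x ^ 2 / rho x ^ 2) B := by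
    refine hi₁.mono' ((hWm.pow 2).div₀ hrm) (Eventually.of_forall fun x => ?_)
    rw [Real.norm_of_nonneg (by positivity)]
    gcongr
    exact pow_le_of_le_one (hWn x) (hW1 x) two_ne_zero
  have hmain := (hardy_sobolev_on_disc hdiff (fun x _ => hWn x) hi₁ hi₂).2 fun x _ => hW1 x
  have hlow : levelVolume u (t + s) ≤ ∫ x in B, W x ^ 2 / rho x ^ 2 := by
    calc levelVolume u (t + s) = ∫ x in superlevel u (t + s), W x ^ 2 / rho x ^ 2 := by
          refine setIntegral_congr_fun hmts fun x hx => ?_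
          have : W x = 1 := smoothTransition.one_of_one_le
            (by rw [le_div_iff₀ hs]; linarith [hx.2])
          simp [this]
      _ ≤ _ := setIntegral_mono_set hi₃ (Eventually.of_forall fun _ => by positivity)
          (superlevel_subset _).eventuallyLE
  have hup : ∫ x in B, ‖fderiv ℝ W x‖ / rho x ≤
      M / s * ∫ x in S, ‖fderiv ℝ u x‖ * (1 / rho x) := by
    refine (setIntegral_mono_on hi₂ hind measurableSet_B hbd).trans (le_of_eq ?_)
    rw [setIntegral_indicator hSm, inter_eq_self_of_subset_right hSB, integral_const_mul]
  have hup0 : 0 ≤ ∫ x in B, ‖fderiv ℝ W x‖ / rho x :=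
    setIntegral_nonneg measurableSet_B fun x hx => by
      have hr := mem_B_iff.1 hx
      positivity
  have hcs := sq_integral_mul_le (μ := volume.restrict S) hES
    (b := fun x => 1 / rho x) (by simpa [IntegrableOn] using hvolS) hcross
  have hEn : ∫ x in S, ‖fderiv ℝ u x‖ ^ 2 = levelEnergy u t - levelEnergy u (t + s) := by
    rw [hS, setIntegral_sdiff hmts (hE.mono_set (superlevel_subset t)) hsub]
    rfl
  have hVo : ∫ x in S, (1 / rho x) ^ 2 ≤ levelVolume u t := by
    simp only [div_pow, one_pow]
    exact setIntegral_mono_set hvol (Eventually.of_forall fun _ => by positivity)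
      sdiff_subset.eventuallyLE
  rw [hEn] at hcs
  have hEn0 : 0 ≤ levelEnergy u t - levelEnergy u (t + s) :=
    hEn ▸ integral_nonneg fun _ => by positivity
  calc levelVolume u (t + s) ≤ 4 * (∫ x in B, ‖fderiv ℝ W x‖ / rho x) ^ 2 := hlow.trans hmain
    _ ≤ 4 * (M / s * ∫ x in S, ‖fderiv ℝ u x‖ * (1 / rho x)) ^ 2 := by gcongr
    _ = 4 * (M / s) ^ 2 * (∫ x in S, ‖fderiv ℝ u x‖ * (1 / rho x)) ^ 2 := by ring
    _ ≤ 4 * (M / s) ^ 2 * ((levelEnergy u t - levelEnergy u (t + s)) * levelVolume u t) := by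
        gcongr
        exact hcs.trans (mul_le_mul_of_nonneg_left hVo hEn0)
    _ = _ := by ring

lemma tendsto_levelEnergy (hu : DifferentiableOn ℝ u B)
    (hE : IntegrableOn (fun x => ‖fderiv ℝ u x‖ ^ 2) B) :
    Tendsto (fun n : ℕ => levelEnergy u n) atTop (𝓝 0) := by
  have h := tendsto_setIntegral_of_antitone (μ := (volume : Measure Pt))
    (s := fun n : ℕ => superlevel u n) (f := fun x => ‖fderiv ℝ u x‖ ^ 2)
    (fun n => measurableSet_superlevel hu n)
    (fun m n hmn => superlevel_anti (Nat.cast_le.2 hmn))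
    ⟨0, hE.mono_set (superlevel_subset _)⟩
  have he : ⋂ n : ℕ, superlevel u n = ∅ := by
    rw [eq_empty_iff_forall_notMem]
    intro x hx
    obtain ⟨n, hn⟩ := exists_nat_gt (u x)
    exact absurd (mem_iInter.1 hx n).2 hn.le.not_gt
  rw [he, setIntegral_empty] at h
  exact h

lemma exists_levelVolume_le : ∃ K : ℝ, 0 < K ∧ ∀ u : Pt → ℝ, DifferentiableOn ℝ u B →
    IntegrableOn (fun x => ‖fderiv ℝ u x‖ ^ 2) B → IntegrableOn (fun x => u x ^ 2 / rho x ^ 2) B →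
    ∀ t s : ℝ, 0 < t → 0 < s → ∀ n : ℕ,
      levelVolume u (t + n * s) ≤ exp (K * levelEnergy u t / s ^ 2 - n) * levelVolume u t := by
  obtain ⟨K, hK, hstep⟩ := exists_levelVolume_step
  refine ⟨K, hK, fun u hu hE hL t s ht hs n => ?_⟩
  have hind : ∀ n : ℕ, levelVolume u (t + n * s) ≤
      exp (K * (levelEnergy u t - levelEnergy u (t + n * s)) / s ^ 2 - n) * levelVolume u t := by
    intro n
    induction n with
    | zero => simp
    | succ k ih =>
      have h1 := hstep u hu hE hL (t + k * s) s (by positivity) hs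
      have e1 : t + k * s + s = t + ((k + 1 : ℕ) : ℝ) * s := by push_cast; ring
      rw [e1] at h1
      set a := levelEnergy u (t + k * s)
      set b := levelEnergy u (t + ((k + 1 : ℕ) : ℝ) * s)
      have h2 : K * (a - b) / s ^ 2 ≤ exp (K * (a - b) / s ^ 2 - 1) := by
        have := add_one_le_exp (K * (a - b) / s ^ 2 - 1)
        linarith
      calc _ ≤ exp (K * (a - b) / s ^ 2 - 1) * levelVolume u (t + k * s) :=
            h1.trans (mul_le_mul_of_nonneg_right h2 (levelVolume_nonneg _))
        _ ≤ exp (K * (a - b) / s ^ 2 - 1) *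
            (exp (K * (levelEnergy u t - a) / s ^ 2 - k) * levelVolume u t) := by gcongr
        _ = _ := by
            rw [← mul_assoc, ← exp_add]
            congr 2
            push_cast
            ring
  refine (hind n).trans ?_
  have := levelVolume_nonneg (u := u) t
  have := levelEnergy_nonneg (u := u) (t + n * s)
  gcongr
  linarith

lemma exists_integrableOn_exp_superlevel (hu : DifferentiableOn ℝ u B)
    (hE : IntegrableOn (fun x => ‖fderiv ℝ u x‖ ^ 2) B)
    (hL : IntegrableOn (fun x => u x ^ 2 / rho x ^ 2) B) {α : ℝ} (hα : 0 < α) :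
    ∃ T : ℝ, 0 < T ∧
      IntegrableOn (fun x => exp (α * u x ^ 2) / rho x ^ 2) (superlevel u T) := by
  obtain ⟨K, hK, hdecay⟩ := exists_levelVolume_le
  obtain ⟨m, hm⟩ := exists_nat_ge (32 * α + 2)
  have hm0 : (0 : ℝ) < m := by linarith
  have hev : ∀ᶠ n : ℕ in atTop, levelEnergy u n < 1 / (2 * K * m) :=
    (tendsto_levelEnergy hu hE).eventually_lt_const (by positivity)
  obtain ⟨J, hJ⟩ := eventually_atTop.1 (hev.and (eventually_ge_atTop 1))
  have hJ1 : 1 ≤ J := (hJ J le_rfl).2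
  have hvol : ∀ i : ℕ, J ≤ i →
      exp (4 * α * (i + 1) ^ 2) * levelVolume u (2 * i) ≤ exp (-i) * levelVolume u 1 := by
    intro i hi
    have hi1 : (1 : ℝ) ≤ i := Nat.one_le_cast.2 (hJ1.trans hi)
    have hi0 : (0 : ℝ) < i := by linarith
    have h1 := hdecay u hu hE hL i (1 / (m * i)) hi0 (by positivity) (m * i ^ 2)
    have e1 : (i : ℝ) + ((m * i ^ 2 : ℕ) : ℝ) * (1 / (m * i)) = 2 * i := by
      push_cast
      field_simp
      ring
    rw [e1] at h1
    have h2 := levelVolume_anti hu hL one_pos hi1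
    have h3 : K * levelEnergy u i / (1 / ((m : ℝ) * i)) ^ 2 ≤ m * i ^ 2 / 2 := by
      have := (hJ i hi).1.le
      rw [le_div_iff₀ (by positivity)] at this
      have e2 : K * levelEnergy u i / (1 / ((m : ℝ) * i)) ^ 2 =
          (levelEnergy u i * (2 * K * m)) * ((m : ℝ) * i ^ 2 / 2) := by field_simp
      rw [e2]
      exact mul_le_of_le_one_left (by positivity) this
    calc _ ≤ exp (4 * α * (i + 1) ^ 2) *
          (exp (K * levelEnergy u i / (1 / ((m : ℝ) * i)) ^ 2 - (m * i ^ 2 : ℕ)) *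
            levelVolume u 1) := by
          gcongr
          exact h1.trans (by gcongr)
      _ = exp (4 * α * (i + 1) ^ 2 +
          (K * levelEnergy u i / (1 / ((m : ℝ) * i)) ^ 2 - (m * i ^ 2 : ℕ))) *
            levelVolume u 1 := by
          rw [exp_add, ← mul_assoc (exp _)]
      _ ≤ _ := by
          have := levelVolume_nonneg (u := u) 1
          gcongr
          push_cast
          have h4 : ((i : ℝ) + 1) ^ 2 ≤ 4 * i ^ 2 := by nlinarith
          have h5 : 4 * α * ((i : ℝ) + 1) ^ 2 ≤ 4 * α * (4 * i ^ 2) := by gcongr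
          have h6 : (32 * α + 2) * (i : ℝ) ^ 2 ≤ m * i ^ 2 := by gcongr
          nlinarith
  set S : ℕ → Set Pt := fun j =>
    superlevel u (2 * ((j + J : ℕ) : ℝ)) \ superlevel u (2 * (((j + J : ℕ) : ℝ) + 1)) with hS
  have hSm : ∀ j, MeasurableSet (S j) := fun j =>
    (measurableSet_superlevel hu _).diff (measurableSet_superlevel hu _)
  have hSB : ∀ j, S j ⊆ B := fun j => sdiff_subset.trans (superlevel_subset _)
  have hpos : ∀ j : ℕ, (0 : ℝ) < 2 * ((j + J : ℕ) : ℝ) := fun j => by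
    have : 0 < j + J := by omega
    positivity
  have hSb : ∀ j, ∀ x ∈ S j, exp (α * u x ^ 2) / rho x ^ 2 ≤
      exp (4 * α * (((j + J : ℕ) : ℝ) + 1) ^ 2) * (1 / rho x ^ 2) := by
    intro j x hx
    have h1 : u x ≤ 2 * (((j + J : ℕ) : ℝ) + 1) := by
      by_contra h
      exact hx.2 ⟨hx.1.1, not_le.1 h⟩
    have h0 : 0 ≤ u x := (hpos j).le.trans hx.1.2.le
    rw [← mul_one_div (exp (α * u x ^ 2))]
    refine mul_le_mul_of_nonneg_right (exp_le_exp.2 ?_) (by positivity)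
    calc α * u x ^ 2 ≤ α * (2 * (((j + J : ℕ) : ℝ) + 1)) ^ 2 := by gcongr
      _ = _ := by ring
  have hvi : ∀ j, IntegrableOn (fun x => 1 / rho x ^ 2) (superlevel u (2 * ((j + J : ℕ) : ℝ))) :=
    fun j => integrableOn_superlevel hu hL (hpos j)
  have hSi : ∀ j, IntegrableOn (fun x => exp (α * u x ^ 2) / rho x ^ 2) (S j) := by
    intro j
    refine (((hvi j).mono_set sdiff_subset).const_mul _).mono' ?_
      ((ae_restrict_mem (hSm j)).mono fun x hx => ?_) (g := fun x =>
        exp (4 * α * (((j + J : ℕ) : ℝ) + 1) ^ 2) * (1 / rho x ^ 2))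
    · have hum : AEStronglyMeasurable u (volume.restrict (S j)) :=
        (hu.continuousOn.mono (hSB j)).aestronglyMeasurable (hSm j)
      exact (continuous_exp.comp_aestronglyMeasurable ((hum.pow 2).const_mul α)).div₀
        (continuous_rho.pow 2).aestronglyMeasurable
    · rw [Real.norm_of_nonneg (by positivity)]
      exact hSb j x hx
  refine ⟨2 * J, by have := hpos 0; simpa using this, ?_⟩
  have hun : superlevel u (2 * J) ⊆ ⋃ j, S j := by
    intro x hx
    have hx2 : (J : ℝ) < u x / 2 := by linarith [hx.2]
    have hlt : J < ⌈u x / 2⌉₊ := Nat.lt_ceil.2 hx2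
    obtain ⟨j, hj⟩ : ∃ j, ⌈u x / 2⌉₊ = j + J + 1 := ⟨⌈u x / 2⌉₊ - J - 1, by omega⟩
    rw [Nat.ceil_eq_iff (by omega)] at hj
    refine mem_iUnion.2 ⟨j, ⟨hx.1, ?_⟩, fun h => ?_⟩
    · have := hj.1
      simp only [Nat.add_sub_cancel] at this
      linarith
    · have h1 := hj.2
      have h2 := h.2
      push_cast at h1 h2
      linarith
  refine (integrableOn_iUnion_of_summable_integral_norm hSi ?_).mono_set hun
  have hsum : Summable fun j : ℕ => exp (-((j + J : ℕ) : ℝ)) * levelVolume u 1 :=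
    ((summable_nat_add_iff J).2 Real.summable_exp_neg_nat).mul_right _
  refine hsum.of_nonneg_of_le (fun j => integral_nonneg fun _ => norm_nonneg _) fun j => ?_
  refine le_trans ?_ (hvol (j + J) (by omega))
  calc ∫ x in S j, ‖exp (α * u x ^ 2) / rho x ^ 2‖
      ≤ ∫ x in S j, exp (4 * α * (((j + J : ℕ) : ℝ) + 1) ^ 2) * (1 / rho x ^ 2) := by
        refine setIntegral_mono_on (hSi j).norm (((hvi j).mono_set sdiff_subset).const_mul _)
          (hSm j) fun x hx => ?_
        rw [Real.norm_of_nonneg (by positivity)]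
        exact hSb j x hx
    _ ≤ _ := by
        rw [integral_const_mul]
        gcongr
        exact setIntegral_mono_set (hvi j) (Eventually.of_forall fun _ => by positivity)
          sdiff_subset.eventuallyLE

/-- Qualitative Moser–Trudinger integrability in the hyperbolic disc. -/
lemma exists_integrableOn_exp (hu : DifferentiableOn ℝ u B)
    (hE : IntegrableOn (fun x => ‖fderiv ℝ u x‖ ^ 2) B)
    (hL : IntegrableOn (fun x => u x ^ 2 / rho x ^ 2) B) {α : ℝ} (hα : 0 < α) :
    ∃ T : ℝ, 0 < T ∧
      IntegrableOn (fun x => exp (α * u x ^ 2) / rho x ^ 2) {x | x ∈ B ∧ T < |u x|} := by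
  obtain ⟨T₁, hT₁, h₁⟩ := exists_integrableOn_exp_superlevel hu hE hL hα
  obtain ⟨T₂, hT₂, h₂⟩ := exists_integrableOn_exp_superlevel (u := fun x => -u x) hu.neg
    (by simpa [fderiv_fun_neg] using hE) (by simpa using hL) hα
  simp only [neg_sq] at h₂
  refine ⟨max T₁ T₂, lt_max_of_lt_left hT₁, (h₁.union h₂).mono_set fun x hx => ?_⟩
  rcases lt_abs.1 hx.2 with h | h
  · exact Or.inl ⟨hx.1, (le_max_left _ _).trans_lt h⟩
  · exact Or.inr ⟨hx.1, (le_max_right _ _).trans_lt h⟩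

end Trudinger

/-! ### Hyperbolic quantities in terms of `rho` -/

lemma dens_eq (x : Pt) : dens x = 4 * (1 / rho x ^ 2) := by
  rw [dens, rho, div_pow]
  ring

lemma dens_nonneg (x : Pt) : 0 ≤ dens x := sq_nonneg _

lemma norm_gradient (u : Pt → ℝ) (x : Pt) : ‖gradient u x‖ = ‖fderiv ℝ u x‖ :=
  LinearIsometryEquiv.norm_map _ _

lemma measurable_dens : Measurable dens := by
  rw [funext dens_eq]
  exact (measurable_const.div (continuous_rho.pow 2).measurable).const_mul 4

namespace IsH1

variable {u : Pt → ℝ}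

lemma integrableOn_fderiv (hu : IsH1 u) : IntegrableOn (fun x => ‖fderiv ℝ u x‖ ^ 2) B := by
  simpa only [norm_gradient] using hu.2.1

lemma integrableOn_sq_div (hu : IsH1 u) : IntegrableOn (fun x => u x ^ 2 / rho x ^ 2) B := by
  refine (hu.2.2.const_mul (1 / 4)).congr (Eventually.of_forall fun x => ?_)
  simp only [dens_eq]
  ring

/-- Poincaré inequality in the hyperbolic disc. -/
lemma hInt_sq_le (hu : IsH1 u) : hInt (fun x => u x ^ 2) ≤ 4 * enormSq u := by
  have h1 := integral_sq_div_rho_sq_le_energy hu.1 hu.integrableOn_fderiv hu.integrableOn_sq_div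
  have h2 : hInt (fun x => u x ^ 2) = 4 * ∫ x in B, u x ^ 2 / rho x ^ 2 := by
    rw [hInt, ← integral_const_mul]
    congr 1 with x
    rw [dens_eq]
    ring
  simp only [enormSq, norm_gradient]
  linarith

end IsH1

/-! ### Pointwise properties of the nonlinearity -/

lemma fn_mul_self_le {lam : ℝ} {h : Pt → ℝ → ℝ} (hlam : 0 ≤ lam) {x : Pt} {t N H : ℝ}
    (ht : |t| ≤ N) (hH : |h x t| ≤ H) :
    fn lam h x t * t ≤ H * (lam * N * exp (lam * N ^ 2)) * t ^ 2 := by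
  have hN : 0 ≤ N := (abs_nonneg t).trans ht
  have hsq : t ^ 2 ≤ N ^ 2 := sq_le_sq' (abs_le.1 ht).1 (abs_le.1 ht).2
  have h0 : 0 ≤ exp (lam * t ^ 2) - 1 := sub_nonneg.2 (one_le_exp (by positivity))
  have h1 : exp (lam * t ^ 2) - 1 ≤ lam * t ^ 2 * exp (lam * N ^ 2) := by
    have h2 := add_one_le_exp (-(lam * t ^ 2))
    have h3 : exp (lam * t ^ 2) * exp (-(lam * t ^ 2)) = 1 := by rw [← exp_add]; simp
    have h4 : exp (lam * t ^ 2) - 1 ≤ lam * t ^ 2 * exp (lam * t ^ 2) := by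
      nlinarith [exp_pos (lam * t ^ 2)]
    exact h4.trans (by gcongr)
  calc fn lam h x t * t ≤ |fn lam h x t * t| := le_abs_self _
    _ = |h x t| * (exp (lam * t ^ 2) - 1) * |t| := by
        rw [fn, abs_mul, abs_mul, abs_of_nonneg h0]
    _ ≤ H * (lam * t ^ 2 * exp (lam * N ^ 2)) * N := by
        have := (abs_nonneg _).trans hH
        gcongr
    _ = _ := by ring

namespace CriticalGrowth

variable {lam : ℝ} {h : Pt → ℝ → ℝ}

lemma continuous_fn (hf : CriticalGrowth lam h) :
    Continuous (Function.uncurry (fn lam h)) := by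
  have := hf.h_C1.continuous
  unfold fn
  simp only [Function.uncurry_def] at this ⊢
  fun_prop

lemma continuous_fn_apply (hf : CriticalGrowth lam h) (x : Pt) : Continuous (fn lam h x) :=
  hf.continuous_fn.comp (Continuous.prodMk_right x)

lemma differentiable_fn_apply (hf : CriticalGrowth lam h) (x : Pt) :
    Differentiable ℝ (fn lam h x) := by
  have h1 : Differentiable ℝ (fun t => h x t) :=
    (hf.h_C1.differentiable one_ne_zero).comp
      ((differentiable_const x).prodMk differentiable_id : Differentiable ℝ fun t : ℝ => (x, t))
  unfold fn
  fun_prop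

lemma fn_zero (x : Pt) : fn lam h x 0 = 0 := by simp [fn]

lemma fn_nonneg (hf : CriticalGrowth lam h) {x : Pt} (hx : x ∈ B) {t : ℝ} (ht : 0 ≤ t) :
    0 ≤ fn lam h x t := by
  rcases ht.eq_or_lt with rfl | ht
  · rw [fn_zero]
  · exact (hf.f_pos x hx t ht).le

lemma fn_abs_mul_abs (hf : CriticalGrowth lam h) {x : Pt} (hx : x ∈ B) (t : ℝ) :
    fn lam h x |t| * |t| = fn lam h x t * t := by
  rcases abs_choice t with ht | ht
  · rw [ht]
  · rw [ht, hf.f_odd x hx, neg_mul_neg]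

lemma fn_mul_self_nonneg (hf : CriticalGrowth lam h) {x : Pt} (hx : x ∈ B) (t : ℝ) :
    0 ≤ fn lam h x t * t := by
  rw [← hf.fn_abs_mul_abs hx]
  exact mul_nonneg (hf.fn_nonneg hx (abs_nonneg t)) (abs_nonneg t)

lemma Fn_abs (hf : CriticalGrowth lam h) {x : Pt} (hx : x ∈ B) (t : ℝ) :
    Fn lam h x |t| = Fn lam h x t := by
  rcases abs_choice t with ht | ht
  · rw [ht]
  · rw [ht, Fn, Fn]
    have h1 := intervalIntegral.integral_comp_neg (a := 0) (b := t) (fn lam h x)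
    simp only [hf.f_odd x hx, intervalIntegral.integral_neg, neg_zero] at h1
    rw [intervalIntegral.integral_symm, ← h1, neg_neg]

lemma Fn_nonneg (hf : CriticalGrowth lam h) {x : Pt} (hx : x ∈ B) (t : ℝ) :
    0 ≤ Fn lam h x t := by
  rw [← hf.Fn_abs hx]
  exact intervalIntegral.integral_nonneg (abs_nonneg t) fun s hs => hf.fn_nonneg hx hs.1

lemma two_mul_Fn_le (hf : CriticalGrowth lam h) {x : Pt} (hx : x ∈ B) (t : ℝ) :
    2 * Fn lam h x t ≤ fn lam h x t * t := by
  rw [← hf.Fn_abs hx, ← hf.fn_abs_mul_abs hx]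
  have hd : ∀ s, HasDerivAt (fun s => fn lam h x s * s - 2 * Fn lam h x s)
      (deriv (fn lam h x) s * s + fn lam h x s * 1 - 2 * fn lam h x s) s := fun s =>
    ((hf.differentiable_fn_apply x s).hasDerivAt.mul (hasDerivAt_id s)).sub
      (((hf.continuous_fn_apply x).integral_hasStrictDerivAt 0 s).hasDerivAt.const_mul 2)
  have hm : MonotoneOn (fun s => fn lam h x s * s - 2 * Fn lam h x s) (Ici 0) := by
    refine monotoneOn_of_deriv_nonneg (convex_Ici 0)
      (fun s _ => (hd s).continuousAt.continuousWithinAt)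
      (fun s _ => (hd s).differentiableAt.differentiableWithinAt) fun s hs => ?_
    rw [interior_Ici, mem_Ioi] at hs
    rw [(hd s).deriv]
    have := hf.f_super x hx s hs
    rw [div_lt_iff₀ hs] at this
    linarith
  have := hm (mem_Ici.2 le_rfl) (mem_Ici.2 (abs_nonneg t)) (abs_nonneg t)
  simp only [mul_zero, Fn, intervalIntegral.integral_same, sub_zero] at this
  simp only [Fn]
  linarith

lemma continuous_Fn (hf : CriticalGrowth lam h) :
    Continuous (fun p : Pt × ℝ => Fn lam h p.1 p.2) := by
  have h1 := hf.continuous_fn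
  unfold Fn
  exact intervalIntegral.continuous_parametric_intervalIntegral_of_continuous
    (f := fun (p : Pt × ℝ) s => fn lam h p.1 s)
    (h1.comp ((continuous_fst.comp continuous_fst).prodMk continuous_snd)) continuous_snd

lemma hIntegrable_fn_mul_self (hf : CriticalGrowth lam h) {u : Pt → ℝ} (hu : IsH1 u) :
    HIntegrable (fun x => fn lam h x (u x) * u x) := by
  have hlam := hf.lam_pos
  obtain ⟨T, hT, hexp⟩ := exists_integrableOn_exp hu.1 hu.integrableOn_fderiv
    hu.integrableOn_sq_div (by positivity : 0 < 2 * lam + 1)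
  obtain ⟨T', hT'⟩ := hf.h_sup lam hlam 1 one_pos
  set N := max T T'
  have hN : 0 < N := lt_max_of_lt_left hT
  obtain ⟨H, hH⟩ := hf.h_bdd N hN
  set D := H * (lam * N * exp (lam * N ^ 2))
  have hSm : MeasurableSet {x | x ∈ B ∧ T < |u x|} :=
    (hu.1.continuousOn.abs.isOpen_inter_preimage isOpen_B isOpen_Ioi).measurableSet
  set E : Pt → ℝ := indicator {x | x ∈ B ∧ T < |u x|}
    (fun x => exp ((2 * lam + 1) * u x ^ 2) / rho x ^ 2)
  have hE : IntegrableOn E B := ((integrable_indicator_iff hSm).2 hexp).integrableOn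
  have hE0 : ∀ x, 0 ≤ E x := indicator_nonneg fun _ _ => by positivity
  have hcont : ContinuousOn (fun x => fn lam h x (u x) * u x) B :=
    (hf.continuous_fn.comp_continuousOn (continuousOn_id.prodMk hu.1.continuousOn)).mul
      hu.1.continuousOn
  refine ((hu.2.2.const_mul |D|).add (hE.const_mul 4)).mono'
    ((hcont.aestronglyMeasurable measurableSet_B).mul
      measurable_dens.aestronglyMeasurable) ?_
  filter_upwards [ae_restrict_mem measurableSet_B] with x hx
  have hd := dens_nonneg x
  rw [Real.norm_of_nonneg (mul_nonneg (hf.fn_mul_self_nonneg hx _) hd)]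
  simp only [Pi.add_apply]
  rcases le_or_gt |u x| N with hux | hux
  · have h1 := fn_mul_self_le hlam.le hux (hH x hx _ hux)
    have h2 : D * u x ^ 2 ≤ |D| * u x ^ 2 := by gcongr; exact le_abs_self D
    have h3 := mul_le_mul_of_nonneg_right (h1.trans h2) hd
    have := hE0 x
    linarith
  · have hxS : x ∈ {x | x ∈ B ∧ T < |u x|} := ⟨hx, (le_max_left _ _).trans_lt hux⟩
    have h1 := (hT' |u x| ((le_max_right _ _).trans hux.le) x hx).le
    rw [sq_abs] at h1
    have h2 : h x |u x| ≤ exp (lam * u x ^ 2) := by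
      have h3 : exp (lam * u x ^ 2) * exp (-lam * u x ^ 2) = 1 := by
        rw [← exp_add]
        simp
      nlinarith [exp_pos (lam * u x ^ 2)]
    have h4 : |u x| ≤ exp (u x ^ 2) := by
      have h5 := add_one_le_exp (u x ^ 2)
      nlinarith [sq_nonneg (|u x| - 1), sq_abs (u x)]
    have h6 : 0 ≤ exp (lam * u x ^ 2) - 1 := sub_nonneg.2 (one_le_exp (by positivity))
    have h7 : fn lam h x (u x) * u x ≤ exp ((2 * lam + 1) * u x ^ 2) := by
      rw [← hf.fn_abs_mul_abs hx, fn, sq_abs]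
      calc _ ≤ exp (lam * u x ^ 2) * exp (lam * u x ^ 2) * exp (u x ^ 2) := by
            gcongr
            linarith
        _ = _ := by
            rw [← exp_add, ← exp_add]
            ring_nf
    have h8 : E x = exp ((2 * lam + 1) * u x ^ 2) * (1 / rho x ^ 2) := by
      rw [mul_one_div]
      exact indicator_of_mem hxS _
    have h9 := mul_le_mul_of_nonneg_right h7 hd
    have : 0 ≤ |D| * (u x ^ 2 * dens x) := by positivity
    rw [h8]
    rw [dens_eq] at h9 this ⊢
    linarith

lemma hIntegrable_Fn (hf : CriticalGrowth lam h) {u : Pt → ℝ} (hu : IsH1 u) :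
    HIntegrable (fun x => Fn lam h x (u x)) := by
  have hcont : ContinuousOn (fun x => Fn lam h x (u x)) B :=
    hf.continuous_Fn.comp_continuousOn (continuousOn_id.prodMk hu.1.continuousOn)
  refine (hf.hIntegrable_fn_mul_self hu).mono' ((hcont.aestronglyMeasurable measurableSet_B).mul
      measurable_dens.aestronglyMeasurable) ?_
  filter_upwards [ae_restrict_mem measurableSet_B] with x hx
  have h1 := hf.Fn_nonneg hx (u x)
  have h2 := hf.two_mul_Fn_le hx (u x)
  rw [Real.norm_of_nonneg (mul_nonneg h1 (dens_nonneg x))]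
  exact mul_le_mul_of_nonneg_right (by linarith) (dens_nonneg x)

/-- Small values of `u`: the nonlinearity is absorbed by `μ t²` up to a constant supported away
from the boundary. -/
lemma exists_fn_mul_self_le_of_abs_le (hf : CriticalGrowth lam h) (hC5 : CondC5 h) {N μ : ℝ}
    (hN : 0 < N) (hμ : 0 < μ) : ∃ ε D : ℝ, 0 < ε ∧ 0 ≤ D ∧ ∀ x ∈ B, ∀ t : ℝ, |t| ≤ N →
      fn lam h x t * t ≤ {y | ε ≤ rho y}.indicator (fun _ => D) x + μ * t ^ 2 := by
  have hlam := hf.lam_pos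
  obtain ⟨δ, hδ, α₀, hα₀, hC⟩ := hC5
  obtain ⟨C, hC0, hC⟩ := hC N hN
  obtain ⟨H, hH⟩ := hf.h_bdd N hN
  set A := lam * N * exp (lam * N ^ 2)
  have hA : 0 < A := by positivity
  have hlim : Tendsto (fun r : ℝ => C * r ^ δ * A) (𝓝[>] 0) (𝓝 0) := by
    have h1 : ContinuousAt (fun r : ℝ => C * r ^ δ * A) 0 :=
      ((continuousAt_rpow_const _ _ (Or.inr hδ.le)).const_mul C).mul_const A
    have h2 := h1.tendsto
    rw [zero_rpow hδ.ne', mul_zero, zero_mul] at h2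
    exact h2.mono_left nhdsWithin_le_nhds
  obtain ⟨ε₁, hε₁, hε₁'⟩ := mem_nhdsGT_iff_exists_Ioo_subset.1
    (hlim.eventually_lt_const hμ)
  have hα1 : 0 < 1 - α₀ ^ 2 := by nlinarith [hα₀.1, hα₀.2]
  refine ⟨min ε₁ (1 - α₀ ^ 2), |H| * A * N ^ 2, lt_min hε₁ hα1, by positivity,
    fun x hx t ht => ?_⟩
  have htN : t ^ 2 ≤ N ^ 2 := sq_le_sq' (abs_le.1 ht).1 (abs_le.1 ht).2
  by_cases hxε : min ε₁ (1 - α₀ ^ 2) ≤ rho x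
  · rw [indicator_of_mem (show x ∈ {y | min ε₁ (1 - α₀ ^ 2) ≤ rho y} from hxε)]
    have h1 := fn_mul_self_le hlam.le ht ((hH x hx t ht).trans (le_abs_self H))
    have h2 : |H| * A * t ^ 2 ≤ |H| * A * N ^ 2 := by gcongr
    have : 0 ≤ μ * t ^ 2 := by positivity
    linarith
  · rw [indicator_of_notMem (show x ∉ {y | min ε₁ (1 - α₀ ^ 2) ≤ rho y} from hxε), zero_add]
    rw [not_le, lt_min_iff] at hxε
    have hr := mem_B_iff.1 hx
    have hx1 : ‖x‖ < 1 := by simpa [B] using hx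
    have hx2 : α₀ < ‖x‖ := by
      have := hxε.2
      rw [rho] at this
      exact lt_of_pow_lt_pow_left₀ 2 (norm_nonneg x) (by linarith)
    have h1 := fn_mul_self_le hlam.le ht (hC x hx2 hx1 t ht)
    have h2 : C * rho x ^ δ * A < μ := hε₁' ⟨hr, hxε.1⟩
    exact h1.trans (mul_le_mul_of_nonneg_right h2.le (sq_nonneg t))

end CriticalGrowth

lemma hIntegrable_indicator_rho {ε : ℝ} (hε : 0 < ε) (D : ℝ) :
    HIntegrable ({y | ε ≤ rho y}.indicator fun _ => D) := by
  have hm : MeasurableSet {y : Pt | ε ≤ rho y} :=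
    (isClosed_le continuous_const continuous_rho).measurableSet
  have hB : IntegrableOn (fun _ : Pt => |D| * (4 * (1 / ε ^ 2))) B :=
    integrableOn_const (by exact measure_ball_lt_top.ne)
  refine hB.mono' (((measurable_const.indicator hm).mul
    measurable_dens).aestronglyMeasurable) (Eventually.of_forall fun x => ?_)
  by_cases hx : ε ≤ rho x
  · rw [indicator_of_mem (show x ∈ {y | ε ≤ rho y} from hx), norm_mul, Real.norm_eq_abs,
      Real.norm_of_nonneg (dens_nonneg x), dens_eq]
    gcongr
  · rw [indicator_of_notMem (show x ∉ {y | ε ≤ rho y} from hx), zero_mul, norm_zero]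
    positivity

lemma hInt_nonneg {φ : Pt → ℝ} (hφ : ∀ x ∈ B, 0 ≤ φ x) : 0 ≤ hInt φ :=
  setIntegral_nonneg measurableSet_B fun x hx => mul_nonneg (hφ x hx) (dens_nonneg x)

/-- For `f` of critical growth satisfying also (C̄3) and (C5): for every
`μ > 0` there is `C(μ) > 0` such that for every `u ∈ H¹(𝔹²)`,
`∫_B f(x,u)u dv_g ≤ C(μ)(1 + I_λ(u)) + μ‖u‖²`. -/
theorem stmt19 (lam : ℝ) (h : Pt → ℝ → ℝ) (hf : CriticalGrowth lam h)
    (hC3bar : CondC3bar lam h) (hC5 : CondC5 h) :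
    ∀ μ : ℝ, 0 < μ → ∃ C : ℝ, 0 < C ∧ ∀ u : Pt → ℝ, IsH1 u →
      hInt (fun x => fn lam h x (u x) * u x) ≤
        C * (1 + Ilam lam h u) + μ * enormSq u := by

  intro μ hμ
  obtain ⟨C₀, hC₀, g, hg, hgi, -, hFg⟩ := hC3bar
  have hN : 0 < 4 * C₀ := by positivity
  obtain ⟨ε, D, hε, hD, hsmall⟩ :=
    hf.exists_fn_mul_self_le_of_abs_le hC5 hN (by positivity : 0 < μ / 4)
  set χ : Pt → ℝ := {y | ε ≤ rho y}.indicator fun _ => D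
  have hχi : HIntegrable χ := hIntegrable_indicator_rho hε D
  have hχ0 : ∀ x, 0 ≤ χ x := indicator_nonneg fun _ _ => hD
  have hg0 := hInt_nonneg (φ := g) fun x _ => hg x
  have hχ0' := hInt_nonneg (φ := χ) fun x _ => hχ0 x
  refine ⟨4 + 4 * C₀ * hInt g + hInt χ, by positivity, fun u hu => ?_⟩
  have hfu := hf.hIntegrable_fn_mul_self hu
  have hFu := hf.hIntegrable_Fn hu
  have hI : Ilam lam h u = ∫ x in B, (fn lam h x (u x) * u x / 2 - Fn lam h x (u x)) * dens x := by
    rw [Ilam, hInt, hInt, ← integral_const_mul, ← integral_sub (hfu.const_mul _) hFu]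
    congr 1 with x
    ring
  have hGi : IntegrableOn
      (fun x => (fn lam h x (u x) * u x / 2 - Fn lam h x (u x)) * dens x) B := by
    refine ((hfu.const_mul (1 / 2)).sub hFu).congr (Eventually.of_forall fun x => ?_)
    simp only [Pi.sub_apply]
    ring
  have hI0 : 0 ≤ Ilam lam h u := by
    rw [hI]
    refine hInt_nonneg (φ := fun x => fn lam h x (u x) * u x / 2 - Fn lam h x (u x))
      fun x hx => ?_
    have := hf.two_mul_Fn_le hx (u x)
    linarith
  have hpt : ∀ x ∈ B, fn lam h x (u x) * u x ≤
      4 * (fn lam h x (u x) * u x / 2 - Fn lam h x (u x)) + 4 * C₀ * g x +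
        (χ x + μ / 4 * u x ^ 2) := by
    intro x hx
    have h2 := hf.two_mul_Fn_le hx (u x)
    have h3 : 0 ≤ C₀ * g x := mul_nonneg hC₀.le (hg x)
    rcases le_or_gt |u x| (4 * C₀) with hux | hux
    · have := hsmall x hx (u x) hux
      linarith
    · have h4 := hFg x hx |u x| (hN.trans hux)
      have h5 := hf.fn_nonneg hx (abs_nonneg (u x))
      have h6 := mul_le_mul_of_nonneg_left hux.le h5
      rw [hf.fn_abs_mul_abs hx] at h6
      rw [hf.Fn_abs hx] at h4
      have h7 : 0 ≤ μ / 4 * u x ^ 2 := by positivity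
      have h8 := hχ0 x
      linarith
  have h1 := hGi.const_mul 4
  have h2 := hgi.const_mul (4 * C₀)
  have h3 := hu.2.2.const_mul (μ / 4)
  have hmono : hInt (fun x => fn lam h x (u x) * u x) ≤
      4 * Ilam lam h u + 4 * C₀ * hInt g + (hInt χ + μ / 4 * hInt fun x => u x ^ 2) := by
    have h4 := setIntegral_mono_on hfu ((h1.add h2).add (hχi.add h3)) measurableSet_B fun x hx =>
      (mul_le_mul_of_nonneg_right (hpt x hx) (dens_nonneg x)).trans_eq (by
        simp only [Pi.add_apply]
        ring)
    rw [integral_add' (h1.add h2) (hχi.add h3), integral_add' h1 h2, integral_add' hχi h3,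
      integral_const_mul, integral_const_mul, integral_const_mul, ← hI] at h4
    exact h4
  have hP := mul_le_mul_of_nonneg_left hu.hInt_sq_le (by positivity : 0 ≤ μ / 4)
  have h4 : 0 ≤ (4 * C₀ * hInt g + hInt χ) * Ilam lam h u := by positivity
  nlinarith
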